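/- For all i, j ∈ ℤ and all 1 ≤ p, q ≤ l, the operator Ĉ_{ij} := Ê_{ij} − (−1)^{i+j} Ê_{1−j,1−i} commutes with ê*^{pq}, with ẽ^{pq}, and with ẽ**^{pq}: [Ĉ_{ij}, ê*^{pq}] = [Ĉ_{ij}, ẽ^{pq}] = [Ĉ_{ij}, ẽ**^{pq}] = 0. -/

import Mathlib

/-!
Fermionic Fock space of `l` pairs of fermionic fields indexed by `½ + ℤ`.

The Fock space `FFock l` is the exterior algebra on the vector space `FV l` with basis
`v^{ε,p}_{-r}` for `ε ∈ {+,-}` (encoded as `Bool`, `true = +`), `1 ≤ p ≤ l`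
(encoded as `Fin l`) and `r ∈ ½ + ℤ`, `r > 0` (encoded as `n : ℕ` with `r = n + ½`).

For `r > 0`, `ψ^{ε,p}_{-r}` is left exterior multiplication by the basis vector
`v^{ε,p}_{-r}`, and `ψ^{ε,p}_{r}` is the unique odd derivation (i.e. the left
contraction) with `ψ^{ε,p}_{r}(v^{ε',q}_{-r'}) = δ_{ε',-ε} δ_{q,p} δ_{r',r}`.

A general mode `ψ^{ε,p}_{k - ½}` is encoded by `fermion ε p k` for `k : ℤ`.
-/

noncomputable section

/-- Basis index: `(ε, p, n)` corresponds to `v^{ε,p}_{-(n+½)}`. -/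
abbrev FBas (l : ℕ) := Bool × Fin l × ℕ

abbrev FV (l : ℕ) := FBas l →₀ ℂ

/-- The fermionic Fock space: the exterior algebra `Λ(V)`. -/
abbrev FFock (l : ℕ) := ExteriorAlgebra ℂ (FV l)

/-- The vacuum vector `|0⟩ = 1`. -/
def fvac (l : ℕ) : FFock l := 1

/-- Creation operator `ψ^{ε,p}_{-(n+½)}`: left exterior multiplication by `v^{ε,p}_{-(n+½)}`. -/
def psiCr (l : ℕ) (ε : Bool) (p : Fin l) (n : ℕ) : FFock l → FFock l :=
  fun x => ExteriorAlgebra.ι ℂ (Finsupp.single (ε, p, n) (1 : ℂ)) * x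

/-- Annihilation operator `ψ^{ε,p}_{n+½}`: the odd derivation (left contraction) dual to
`v^{-ε,p}_{-(n+½)}`. -/
def psiAn (l : ℕ) (ε : Bool) (p : Fin l) (n : ℕ) : FFock l → FFock l :=
  fun x => CliffordAlgebra.contractLeft (Q := (0 : QuadraticForm ℂ (FV l)))
    (Finsupp.lapply ((!ε, p, n) : FBas l)) x

/-- `fermion ε p k` is the mode `ψ^{ε,p}_{k-½}`, for `k : ℤ`. -/
def fermion (l : ℕ) (ε : Bool) (p : Fin l) (k : ℤ) : FFock l → FFock l :=
  if k ≤ 0 then psiCr l ε p (-k).toNat else psiAn l ε p (k - 1).toNat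

/-- Normal ordered product `:ψ^{ε₁,p₁}_{k₁-½} ψ^{ε₂,p₂}_{k₂-½}:`, which is
`-ψ₂ ψ₁` if `k₁ - ½ > 0 > k₂ - ½` and `ψ₁ ψ₂` otherwise. -/
def nPsi (l : ℕ) (ε₁ : Bool) (p₁ : Fin l) (k₁ : ℤ) (ε₂ : Bool) (p₂ : Fin l) (k₂ : ℤ) :
    FFock l → FFock l :=
  if 1 ≤ k₁ ∧ k₂ ≤ 0 then fun x => -(fermion l ε₂ p₂ k₂ (fermion l ε₁ p₁ k₁ x))
  else fun x => fermion l ε₁ p₁ k₁ (fermion l ε₂ p₂ k₂ x)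

/-- `Ê_{ij} = Σ_{p=1}^{l} :ψ^{+,p}_{½-i} ψ^{-,p}_{j-½}:` (note `½ - i = (1-i) - ½`). -/
def Ehat (l : ℕ) (i j : ℤ) : FFock l → FFock l :=
  fun x => ∑ p : Fin l, nPsi l true p (1 - i) false p j x

/-- `ê*^{pq} = Σ_{r ∈ ½+ℤ} :ψ^{+,p}_{-r} ψ^{-,q}_{r}:`, parametrizing `r = k - ½`, `k : ℤ`;
only finitely many summands act nonzero on a given vector, so the sum (`∑ᶠ`) is well defined. -/
def estar (l : ℕ) (p q : Fin l) : FFock l → FFock l :=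
  fun x => ∑ᶠ k : ℤ, nPsi l true p (1 - k) false q k x

/-- `ê^{pq} = Σ_{r ∈ ½+ℤ} :ψ^{-,p}_{-r} ψ^{-,q}_{r}:`. -/
def ee (l : ℕ) (p q : Fin l) : FFock l → FFock l :=
  fun x => ∑ᶠ k : ℤ, nPsi l false p (1 - k) false q k x

/-- `ê**^{pq} = Σ_{r ∈ ½+ℤ} :ψ^{+,p}_{-r} ψ^{+,q}_{r}:`. -/
def estarstar (l : ℕ) (p q : Fin l) : FFock l → FFock l :=
  fun x => ∑ᶠ k : ℤ, nPsi l true p (1 - k) true q k x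

/-- `ẽ^{pq} = Σ_{r ∈ ½+ℤ} (-1)^{r+½} ψ^{-,p}_{-r} ψ^{-,q}_{r}`, parametrizing `r = k - ½`
(so that `(-1)^{r+½} = (-1)^k`). -/
def eeTw (l : ℕ) (p q : Fin l) : FFock l → FFock l :=
  fun x => ∑ᶠ k : ℤ, ((-1 : ℂ) ^ k) • fermion l false p (1 - k) (fermion l false q k x)

/-- `ẽ**^{pq} = Σ_{r ∈ ½+ℤ} (-1)^{r+½} ψ^{+,p}_{-r} ψ^{+,q}_{r}`. -/
def estarstarTw (l : ℕ) (p q : Fin l) : FFock l → FFock l :=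
  fun x => ∑ᶠ k : ℤ, ((-1 : ℂ) ^ k) • fermion l true p (1 - k) (fermion l true q k x)

/-- `Ĉ_{ij} := Ê_{ij} - (-1)^{i+j} Ê_{1-j,1-i}`. -/
def Chat (l : ℕ) (i j : ℤ) : FFock l → FFock l :=
  fun x => Ehat l i j x - ((-1 : ℂ) ^ (i + j)) • Ehat l (1 - j) (1 - i) x

/-- The mode `ψ^{ε,p}_{k-½}` as a linear endomorphism of the Fock space. -/
def fermionEnd (l : ℕ) (ε : Bool) (p : Fin l) (k : ℤ) : Module.End ℂ (FFock l) :=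
  if k ≤ 0 then
    LinearMap.mulLeft ℂ
      (ExteriorAlgebra.ι ℂ (Finsupp.single ((ε, p, (-k).toNat) : FBas l) (1 : ℂ)))
  else
    CliffordAlgebra.contractLeft (Q := (0 : QuadraticForm ℂ (FV l)))
      (Finsupp.lapply ((!ε, p, (k - 1).toNat) : FBas l))

theorem fermionEnd_apply (l : ℕ) (ε : Bool) (p : Fin l) (k : ℤ) (x : FFock l) :
    fermionEnd l ε p k x = fermion l ε p k x := by
  unfold fermionEnd fermion
  split_ifs <;> rfl

theorem fermionEnd_of_nonpos {l : ℕ} (ε : Bool) (p : Fin l) {k : ℤ} (hk : k ≤ 0) (x : FFock l) :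
    fermionEnd l ε p k x =
      ExteriorAlgebra.ι ℂ (Finsupp.single ((ε, p, (-k).toNat) : FBas l) (1 : ℂ)) * x := by
  simp [fermionEnd, hk]

theorem fermionEnd_of_pos {l : ℕ} (ε : Bool) (p : Fin l) {k : ℤ} (hk : ¬ k ≤ 0) (x : FFock l) :
    fermionEnd l ε p k x =
      CliffordAlgebra.contractLeft (Q := (0 : QuadraticForm ℂ (FV l)))
        (Finsupp.lapply ((!ε, p, (k - 1).toNat) : FBas l)) x := by
  simp [fermionEnd, hk]

theorem contractLeft_ι_mul_fock {l : ℕ} (d : Module.Dual ℂ (FV l)) (m : FV l) (x : FFock l) :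
    CliffordAlgebra.contractLeft (Q := (0 : QuadraticForm ℂ (FV l))) d
        (ExteriorAlgebra.ι ℂ m * x) =
      d m • x - ExteriorAlgebra.ι ℂ m *
        CliffordAlgebra.contractLeft (Q := (0 : QuadraticForm ℂ (FV l))) d x :=
  CliffordAlgebra.contractLeft_ι_mul (d := d) m x

/-- Canonical anticommutation of an annihilation mode with a creation mode. -/
theorem fermionEnd_anticomm_of_pos_of_nonpos {l : ℕ} (ε ε' : Bool) (p q : Fin l) {a b : ℤ}
    (ha : ¬ a ≤ 0) (hb : b ≤ 0) :
    fermionEnd l ε p a * fermionEnd l ε' q b + fermionEnd l ε' q b * fermionEnd l ε p a =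
      if ε' = !ε ∧ p = q ∧ a + b = 1 then 1 else 0 := by
  refine LinearMap.ext fun x => ?_
  simp only [LinearMap.add_apply, Module.End.mul_apply, fermionEnd_of_nonpos _ _ hb,
    fermionEnd_of_pos _ _ ha, contractLeft_ι_mul_fock, sub_add_cancel, Finsupp.lapply_apply,
    Finsupp.single_apply, Prod.mk.injEq]
  have hn : (-b).toNat = (a - 1).toNat ↔ a + b = 1 := by omega
  simp only [hn, eq_comm (a := p)]
  split_ifs <;> simp

/-- The canonical anticommutation relations of the fermionic modes. -/
theorem fermionEnd_anticomm {l : ℕ} (ε ε' : Bool) (p q : Fin l) (a b : ℤ) :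
    fermionEnd l ε p a * fermionEnd l ε' q b + fermionEnd l ε' q b * fermionEnd l ε p a =
      if ε' = !ε ∧ p = q ∧ a + b = 1 then 1 else 0 := by
  by_cases ha : a ≤ 0 <;> by_cases hb : b ≤ 0
  · rw [if_neg (by omega)]
    refine LinearMap.ext fun x => ?_
    simp only [LinearMap.add_apply, Module.End.mul_apply, fermionEnd_of_nonpos _ _ hb,
      fermionEnd_of_nonpos _ _ ha, ← mul_assoc, ← add_mul, ExteriorAlgebra.ι_add_mul_swap,
      zero_mul, LinearMap.zero_apply]
  · rw [add_comm, fermionEnd_anticomm_of_pos_of_nonpos ε' ε q p hb ha]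
    congr 1
    rw [eq_comm (a := p), add_comm b a]
    cases ε <;> cases ε' <;> simp
  · exact fermionEnd_anticomm_of_pos_of_nonpos ε ε' p q ha hb
  · rw [if_neg (by omega)]
    refine LinearMap.ext fun x => ?_
    simp only [LinearMap.add_apply, Module.End.mul_apply, fermionEnd_of_pos _ _ hb,
      fermionEnd_of_pos _ _ ha, LinearMap.zero_apply]
    rw [CliffordAlgebra.contractLeft_comm, neg_add_cancel]

/-- Only finitely many contractions with dual basis vectors act nontrivially on a given vector. -/
theorem finite_contractLeft_ne_zero {l : ℕ} (x : FFock l) :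
    {b : FBas l | CliffordAlgebra.contractLeft (Q := (0 : QuadraticForm ℂ (FV l)))
      (Finsupp.lapply b) x ≠ 0}.Finite := by
  induction x using CliffordAlgebra.left_induction with
  | algebraMap r => simp [CliffordAlgebra.contractLeft_algebraMap]
  | add x y hx hy =>
    refine (hx.union hy).subset fun b hb => ?_
    by_contra h
    simp only [Set.mem_union, Set.mem_ofPred_eq, not_or, not_not] at h
    exact hb (by rw [map_add, h.1, h.2, add_zero])
  | ι_mul x m hx =>
    refine (hx.union m.hasFiniteSupport).subset fun b hb => ?_
    by_contra h
    simp only [Set.mem_union, Set.mem_ofPred_eq, not_or, not_not, Function.mem_support] at h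
    exact hb (by rw [CliffordAlgebra.contractLeft_ι_mul, h.1]; simp [h.2])

theorem finite_fermionEnd_ne_zero {l : ℕ} (ε : Bool) (p : Fin l) (x : FFock l) :
    {k : ℤ | 1 ≤ k ∧ fermionEnd l ε p k x ≠ 0}.Finite := by
  refine ((finite_contractLeft_ne_zero x).image fun b : FBas l => (b.2.2 : ℤ) + 1).subset ?_
  rintro k ⟨hk, h⟩
  rw [fermionEnd_of_pos _ _ (by omega)] at h
  exact ⟨_, h, by simp only; omega⟩

/-- A family indexed by `k` whose members vanish at `x` as soon as an annihilation mode `ψ_k`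
or `ψ_{1-k}` does is locally finite. -/
theorem finite_support_of_fermionEnd {l : ℕ} (ε ε' : Bool) (p q : Fin l)
    (f : ℤ → Module.End ℂ (FFock l)) (x : FFock l)
    (h₁ : ∀ k, 1 ≤ k → fermionEnd l ε' q k x = 0 → f k x = 0)
    (h₂ : ∀ k, k ≤ 0 → fermionEnd l ε p (1 - k) x = 0 → f k x = 0) :
    (Function.support fun k => f k x).Finite := by
  refine ((finite_fermionEnd_ne_zero ε' q x).union
    ((finite_fermionEnd_ne_zero ε p x).image fun k => 1 - k)).subset fun k hk => ?_
  rcases le_or_gt 1 k with h | h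
  · exact Or.inl ⟨h, fun h0 => hk (h₁ k h h0)⟩
  · exact Or.inr ⟨1 - k, ⟨by omega, fun h0 => hk (h₂ k (by omega) h0)⟩, by simp⟩

/-- The commutator of two elements of a ring. -/
def opComm {A : Type*} [Ring A] (a b : A) : A := a * b - b * a

section opComm

variable {A : Type*} [Ring A]

theorem opComm_sub_left (a b d : A) : opComm (a - b) d = opComm a d - opComm b d := by
  simp only [opComm, sub_mul, mul_sub]
  abel

theorem opComm_smul_left {R : Type*} [CommRing R] [Algebra R A] (r : R) (a d : A) :
    opComm (r • a) d = r • opComm a d := by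
  simp [opComm, smul_sub]

theorem opComm_smul_right {R : Type*} [CommRing R] [Algebra R A] (r : R) (a d : A) :
    opComm a (r • d) = r • opComm a d := by
  simp [opComm, smul_sub]

theorem opComm_sum_left {ι : Type*} (S : Finset ι) (f : ι → A) (d : A) :
    opComm (∑ n ∈ S, f n) d = ∑ n ∈ S, opComm (f n) d := by
  simp only [opComm, Finset.sum_mul, Finset.mul_sum, Finset.sum_sub_distrib]

theorem opComm_swap (a b : A) : opComm a b = -opComm b a := by
  simp only [opComm, neg_sub]

theorem opComm_mul_right (a b d : A) : opComm a (b * d) = opComm a b * d + b * opComm a d := by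
  simp only [opComm, sub_mul, mul_sub, mul_assoc]
  abel

theorem opComm_mul_left_eq_anticomm (a b d : A) :
    opComm (a * b) d = a * (b * d + d * b) - (a * d + d * a) * b := by
  simp only [opComm, add_mul, mul_add, mul_assoc]
  abel

/-- If `a` and `b` anticommute up to a central element, then `-(b * a)` and `a * b` have the
same commutators. -/
theorem opComm_neg_mul_of_anticomm {a b z : A} (h : a * b + b * a = z) (T : A)
    (hz : T * z = z * T) : opComm T (-(b * a)) = opComm T (a * b) := by
  have h' : -(b * a) = a * b - z := by rw [← h]; abel
  rw [h', opComm, opComm, mul_sub, sub_mul, hz]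
  abel

end opComm

/-- The normal ordered product as a linear endomorphism. -/
def nPsiEnd (l : ℕ) (ε₁ : Bool) (p₁ : Fin l) (k₁ : ℤ) (ε₂ : Bool) (p₂ : Fin l) (k₂ : ℤ) :
    Module.End ℂ (FFock l) :=
  if 1 ≤ k₁ ∧ k₂ ≤ 0 then -(fermionEnd l ε₂ p₂ k₂ * fermionEnd l ε₁ p₁ k₁)
  else fermionEnd l ε₁ p₁ k₁ * fermionEnd l ε₂ p₂ k₂

theorem nPsiEnd_apply (l : ℕ) (ε₁ : Bool) (p₁ : Fin l) (k₁ : ℤ) (ε₂ : Bool) (p₂ : Fin l)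
    (k₂ : ℤ) (x : FFock l) :
    nPsiEnd l ε₁ p₁ k₁ ε₂ p₂ k₂ x = nPsi l ε₁ p₁ k₁ ε₂ p₂ k₂ x := by
  unfold nPsiEnd nPsi
  split_ifs <;> simp [fermionEnd_apply]

/-- Commuting with the normal ordered product is the same as commuting with the product. -/
theorem opComm_nPsiEnd {l : ℕ} (ε₁ : Bool) (p₁ : Fin l) (k₁ : ℤ) (ε₂ : Bool) (p₂ : Fin l) (k₂ : ℤ)
    (T : Module.End ℂ (FFock l)) :
    opComm T (nPsiEnd l ε₁ p₁ k₁ ε₂ p₂ k₂) =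
      opComm T (fermionEnd l ε₁ p₁ k₁ * fermionEnd l ε₂ p₂ k₂) := by
  unfold nPsiEnd
  split_ifs
  · refine opComm_neg_mul_of_anticomm (fermionEnd_anticomm ε₁ ε₂ p₁ p₂ k₁ k₂) T ?_
    split_ifs <;> simp
  · rfl

/-- `Ê_{ij}` as a linear endomorphism. -/
def EhatEnd (l : ℕ) (i j : ℤ) : Module.End ℂ (FFock l) :=
  ∑ p : Fin l, nPsiEnd l true p (1 - i) false p j

theorem EhatEnd_apply (l : ℕ) (i j : ℤ) (x : FFock l) : EhatEnd l i j x = Ehat l i j x := by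
  simp [EhatEnd, Ehat, LinearMap.sum_apply, nPsiEnd_apply]

theorem nPsiEnd_opComm {l : ℕ} (ε₁ : Bool) (p₁ : Fin l) (k₁ : ℤ) (ε₂ : Bool) (p₂ : Fin l) (k₂ : ℤ)
    (T : Module.End ℂ (FFock l)) :
    opComm (nPsiEnd l ε₁ p₁ k₁ ε₂ p₂ k₂) T =
      opComm (fermionEnd l ε₁ p₁ k₁ * fermionEnd l ε₂ p₂ k₂) T := by
  rw [opComm_swap, opComm_nPsiEnd, ← opComm_swap]

theorem EhatEnd_opComm_true {l : ℕ} (i j k : ℤ) (p : Fin l) :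
    opComm (EhatEnd l i j) (fermionEnd l true p k) =
      if k = 1 - j then fermionEnd l true p (1 - i) else 0 := by
  have hk : j + k = 1 ↔ k = 1 - j := by omega
  simp only [EhatEnd, opComm_sum_left, nPsiEnd_opComm, opComm_mul_left_eq_anticomm,
    fermionEnd_anticomm, hk]
  by_cases h : k = 1 - j <;> simp [h]

theorem EhatEnd_opComm_false {l : ℕ} (i j k : ℤ) (p : Fin l) :
    opComm (EhatEnd l i j) (fermionEnd l false p k) =
      if k = i then -fermionEnd l false p j else 0 := by
  have hk : 1 - i + k = 1 ↔ k = i := by omega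
  simp only [EhatEnd, opComm_sum_left, nPsiEnd_opComm, opComm_mul_left_eq_anticomm,
    fermionEnd_anticomm, hk]
  by_cases h : k = i <;> simp [h]

/-- `Ĉ_{ij}` as a linear endomorphism. -/
def ChatEnd (l : ℕ) (i j : ℤ) : Module.End ℂ (FFock l) :=
  EhatEnd l i j - ((-1 : ℂ) ^ (i + j)) • EhatEnd l (1 - j) (1 - i)

theorem ChatEnd_apply (l : ℕ) (i j : ℤ) (x : FFock l) : ChatEnd l i j x = Chat l i j x := by
  simp [ChatEnd, Chat, EhatEnd_apply]

theorem neg_one_zpow_mul_self (n : ℤ) : (-1 : ℂ) ^ n * (-1 : ℂ) ^ n = 1 := by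
  rw [← mul_zpow]
  simp

/-- The action of `Ĉ_{ij}` on the fermionic modes. -/
theorem ChatEnd_opComm {l : ℕ} (i j k : ℤ) (ε : Bool) (p : Fin l) :
    opComm (ChatEnd l i j) (fermionEnd l ε p k) =
      (if ε then (1 : ℂ) else (-1) ^ (i + j)) •
        ((if k = 1 - j then fermionEnd l ε p (1 - i) else 0) -
          (-1 : ℂ) ^ (i + j) • (if k = i then fermionEnd l ε p j else 0)) := by
  have hs := neg_one_zpow_mul_self (i + j)
  cases ε
  · simp only [ChatEnd, opComm_sub_left, opComm_smul_left, EhatEnd_opComm_false, smul_sub,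
      smul_smul, hs, Bool.false_eq_true, if_false, one_smul]
    split_ifs <;> simp [sub_eq_add_neg, add_comm]
  · simp [ChatEnd, opComm_sub_left, opComm_smul_left, EhatEnd_opComm_true]

/-- `Ĉ_{ij}` commutes with a locally finite sum `Σ_k f_k` whose terms agree, up to operators
commuting with `Ĉ_{ij}`, with `w_k ψ^{ε,p}_{1-k} ψ^{ε',q}_k` for suitable weights `w`. -/
theorem ChatEnd_comm_finsum {l : ℕ} (i j : ℤ) (ε ε' : Bool) (p q : Fin l) (w : ℤ → ℂ)
    (f : ℤ → Module.End ℂ (FFock l))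
    (hf : ∀ k, opComm (ChatEnd l i j) (f k) =
      w k • opComm (ChatEnd l i j) (fermionEnd l ε p (1 - k) * fermionEnd l ε' q k))
    (hfin : ∀ x, (Function.support fun k => f k x).Finite)
    (hw₁ : (if ε then (1 : ℂ) else (-1) ^ (i + j)) * w j =
      (if ε' then (1 : ℂ) else (-1) ^ (i + j)) * (-1) ^ (i + j) * w i)
    (hw₂ : (if ε then (1 : ℂ) else (-1) ^ (i + j)) * (-1) ^ (i + j) * w (1 - i) =
      (if ε' then (1 : ℂ) else (-1) ^ (i + j)) * w (1 - j))
    (x : FFock l) :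
    ChatEnd l i j (∑ᶠ k, f k x) = ∑ᶠ k, f k (ChatEnd l i j x) := by
  set C := ChatEnd l i j with hC
  set c := (if ε then (1 : ℂ) else (-1) ^ (i + j)) with hc
  set c' := (if ε' then (1 : ℂ) else (-1) ^ (i + j)) with hc'
  set s := (-1 : ℂ) ^ (i + j) with hs
  set P := fermionEnd l ε p (1 - i) * fermionEnd l ε' q j with hP
  set R := fermionEnd l ε p j * fermionEnd l ε' q (1 - i) with hR
  have hterm : ∀ k, C (f k x) - f k (C x) =
      (Pi.single j ((c * w j) • P x) : ℤ → FFock l) k +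
        (Pi.single (1 - i) (-((c * s * w (1 - i)) • R x)) : ℤ → FFock l) k +
        (Pi.single (1 - j) ((c' * w (1 - j)) • R x) : ℤ → FFock l) k +
        (Pi.single i (-((c' * s * w i) • P x)) : ℤ → FFock l) k := by
    intro k
    have h1 : C (f k x) - f k (C x) = opComm C (f k) x := rfl
    have e1 : 1 - k = 1 - j ↔ k = j := by omega
    have e2 : 1 - k = i ↔ k = 1 - i := by omega
    rw [h1, hf, opComm_mul_right, hC, ChatEnd_opComm, ChatEnd_opComm, ← hc, ← hc', ← hs]
    simp only [e1, e2, Pi.single_apply]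
    have t1 : (if k = j then fermionEnd l ε p (1 - i) else 0) * fermionEnd l ε' q k =
        if k = j then P else 0 := by
      split_ifs with h <;> simp [h, hP]
    have t2 : (if k = 1 - i then fermionEnd l ε p j else 0) * fermionEnd l ε' q k =
        if k = 1 - i then R else 0 := by
      split_ifs with h <;> simp [h, hR]
    have t3 : fermionEnd l ε p (1 - k) * (if k = 1 - j then fermionEnd l ε' q (1 - i) else 0) =
        if k = 1 - j then R else 0 := by
      split_ifs with h <;> simp [h, hR]
    have t4 : fermionEnd l ε p (1 - k) * (if k = i then fermionEnd l ε' q j else 0) =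
        if k = i then P else 0 := by
      split_ifs with h <;> simp [h, hP]
    rw [smul_mul_assoc, mul_smul_comm, sub_mul, mul_sub, smul_mul_assoc, mul_smul_comm,
      t1, t2, t3, t4]
    have u1 : w k • c • (if k = j then P else 0) x = if k = j then (c * w j) • P x else 0 := by
      split_ifs with h
      · rw [h, smul_smul, mul_comm]
      · simp
    have u2 : w k • c • s • (if k = 1 - i then R else 0) x =
        -(if k = 1 - i then -((c * s * w (1 - i)) • R x) else 0) := by
      split_ifs with h
      · rw [h, smul_smul, smul_smul, neg_neg]; congr 1; ring
      · simp
    have u3 : w k • c' • (if k = 1 - j then R else 0) x =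
        if k = 1 - j then (c' * w (1 - j)) • R x else 0 := by
      split_ifs with h
      · rw [h, smul_smul, mul_comm]
      · simp
    have u4 : w k • c' • s • (if k = i then P else 0) x =
        -(if k = i then -((c' * s * w i) • P x) else 0) := by
      split_ifs with h
      · rw [h, smul_smul, smul_smul, neg_neg]; congr 1; ring
      · simp
    simp only [LinearMap.smul_apply, LinearMap.add_apply, LinearMap.sub_apply, smul_add, smul_sub,
      u1, u2, u3, u4]
    abel
  have hsing : ∀ (a : ℤ) (y : FFock l), (Function.support (Pi.single a y : ℤ → FFock l)).Finite :=
    fun a y => (Set.finite_singleton a).subset Pi.support_single_subset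
  have hsum : ∀ (a : ℤ) (y : FFock l), ∑ᶠ k, (Pi.single a y : ℤ → FFock l) k = y := by
    intro a y
    rw [finsum_eq_single _ a fun k hk => Pi.single_eq_of_ne hk _, Pi.single_eq_same]
  have hfinC : (Function.support fun k => C (f k x)).Finite :=
    (hfin x).subset fun k hk h0 => hk (by simp only at h0 ⊢; rw [h0, map_zero])
  have hmap : C (∑ᶠ k, f k x) = ∑ᶠ k, C (f k x) :=
    C.toAddMonoidHom.map_finsum (hfin x)
  rw [hmap, ← sub_eq_zero, ← finsum_sub_distrib hfinC (hfin (C x)), finsum_congr hterm]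
  have h12 := ((hsing j ((c * w j) • P x)).union
    (hsing (1 - i) (-((c * s * w (1 - i)) • R x)))).subset (Function.support_add _ _)
  have h123 := (h12.union (hsing (1 - j) ((c' * w (1 - j)) • R x))).subset
    (Function.support_add _ _)
  rw [finsum_add_distrib h123 (hsing _ _), finsum_add_distrib h12 (hsing _ _),
    finsum_add_distrib (hsing _ _) (hsing _ _), hsum, hsum, hsum, hsum, hw₁, hw₂]
  abel

/-- `Ĉ_{ij}` commutes with the twisted sum of products of two modes of the same sign. -/
theorem ChatEnd_comm_twisted_sum {l : ℕ} (i j : ℤ) (ε : Bool) (p q : Fin l) (x : FFock l) :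
    ChatEnd l i j (∑ᶠ k : ℤ, ((-1 : ℂ) ^ k) • fermion l ε p (1 - k) (fermion l ε q k x)) =
      ∑ᶠ k : ℤ, ((-1 : ℂ) ^ k) • fermion l ε p (1 - k) (fermion l ε q k (ChatEnd l i j x)) := by
  have h0 : (-1 : ℂ) ≠ 0 := by norm_num
  have hj : (-1 : ℂ) ^ (i + j) * (-1) ^ i = (-1) ^ j := by
    rw [zpow_add₀ h0, mul_right_comm, neg_one_zpow_mul_self, one_mul]
  have hi : (-1 : ℂ) ^ (i + j) * (-1) ^ (1 - i) = (-1) ^ (1 - j) := by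
    rw [← zpow_add₀ h0, show i + j + (1 - i) = (1 - j) + (j + j) by ring, zpow_add₀ h0,
      zpow_add₀ h0 j j, neg_one_zpow_mul_self, mul_one]
  have key := ChatEnd_comm_finsum i j ε ε p q (fun k => (-1 : ℂ) ^ k)
    (fun k => ((-1 : ℂ) ^ k) • (fermionEnd l ε p (1 - k) * fermionEnd l ε q k))
    (fun k => opComm_smul_right _ _ _) (fun y => finite_support_of_fermionEnd ε ε p q _ y ?_ ?_)
    (by rw [mul_assoc, hj]) (by rw [mul_assoc, hi]) x
  · simpa only [LinearMap.smul_apply, Module.End.mul_apply, fermionEnd_apply] using key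
  · intro k _ h
    simp [h]
  · intro k _ h
    have hanti := fermionEnd_anticomm ε ε p q (1 - k) k
    rw [if_neg (by simp)] at hanti
    rw [eq_neg_of_add_eq_zero_left hanti]
    simp [h]

theorem ChatEnd_comm_estar {l : ℕ} (i j : ℤ) (p q : Fin l) (x : FFock l) :
    ChatEnd l i j (estar l p q x) = estar l p q (ChatEnd l i j x) := by
  have key := ChatEnd_comm_finsum i j true false p q (fun _ => 1)
    (fun k => nPsiEnd l true p (1 - k) false q k)
    (fun k => by rw [one_smul, opComm_nPsiEnd])
    (fun y => finite_support_of_fermionEnd true false p q _ y ?_ ?_)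
    (by simp [neg_one_zpow_mul_self]) (by simp) x
  · simpa only [nPsiEnd_apply, estar] using key
  · intro k hk h
    rw [nPsiEnd, if_neg (by omega)]
    simp [h]
  · intro k hk h
    rw [nPsiEnd, if_pos (by omega)]
    simp [h]

/-- for all `i, j ∈ ℤ` and all `1 ≤ p, q ≤ l`, the operator
`Ĉ_{ij} = Ê_{ij} - (-1)^{i+j} Ê_{1-j,1-i}` commutes with `ê*^{pq}`, with `ẽ^{pq}` and
with `ẽ**^{pq}`. -/
theorem Chat_comm_twisted (l : ℕ) (hl : 1 ≤ l) (i j : ℤ) (p q : Fin l) (x : FFock l) :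
    Chat l i j (estar l p q x) = estar l p q (Chat l i j x) ∧
    Chat l i j (eeTw l p q x) = eeTw l p q (Chat l i j x) ∧
    Chat l i j (estarstarTw l p q x) = estarstarTw l p q (Chat l i j x) := by
  simp only [← ChatEnd_apply]
  exact ⟨ChatEnd_comm_estar i j p q x, ChatEnd_comm_twisted_sum i j false p q x,
    ChatEnd_comm_twisted_sum i j true p q x⟩

end
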